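/- Let p ≥ 2 and n ≥ 1 be integers. There exist real constants a₁ > a₂ > ⋯ > aₙ > 0 such that (i) for independent X₁,…,Xₙ each uniform on {p−1, p−3, …, 1−p}, the variable X̃ = ∑_{j=1}^n a_jX_j matches the first 2n moments of Y uniform on [−1,1], and (ii) for every choice of values x_j ∈ {p−1, p−3, …, 1−p}, the number ∑_{j=1}^n a_j x_j lies in the open interval (∑_{j=1}^n x_j p^{−j} − p^{−n}, ∑_{j=1}^n x_j p^{−j} + p^{−n}), which is contained in (−1,1); consequently, if [−1,1] is cut into pⁿ equal subintervals, each subinterval contains exactly one of the pⁿ values ∑ a_j x_j, and the ordering of these values as real numbers coincides with dictionary order on the vectors (x₁,…,xₙ). -/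

import Mathlib

/-- The value of `X̃ = ∑ aⱼ Xⱼ` when `Xⱼ` takes the value `p - 1 - 2·(x j)`
in the arithmetic progression `{p-1, p-3, …, 1-p}`. -/
noncomputable def Xsum (p n : ℕ) (a : Fin n → ℝ) (x : Fin n → Fin p) : ℝ :=
  ∑ j, a j * ((p : ℝ) - 1 - 2 * ((x j : ℕ) : ℝ))

/-- `X̃ = ∑ aⱼ Xⱼ` matches the first `2n` moments of `Y` uniform on `[-1,1]`. -/
def MatchesMoments (p n : ℕ) (a : Fin n → ℝ) : Prop :=
  ∀ m : ℕ, 1 ≤ m → m ≤ 2 * n →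
    (1 / (p : ℝ) ^ n) * ∑ x : Fin n → Fin p, (Xsum p n a x) ^ m
      = if Even m then 1 / ((m : ℝ) + 1) else 0

/-- The "ruler midpoint" `∑ xⱼ p^{-j}` associated to the tuple of values
`xⱼ ∈ {p-1, p-3, …, 1-p}`. -/
noncomputable def midpt (p n : ℕ) (x : Fin n → Fin p) : ℝ :=
  ∑ j, ((p : ℝ) - 1 - 2 * ((x j : ℕ) : ℝ)) * ((p : ℝ) ^ ((j : ℕ) + 1))⁻¹

open Finset

/-- The coefficients `∏_{i=1}^k (Qⁱ - 1)⁻¹` of the product `∏_{i ≥ 1} (1 + X / Qⁱ)`. -/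
noncomputable def eulerCoeff (Q : ℝ) (k : ℕ) : ℝ := ∏ i ∈ range k, (Q ^ (i + 1) - 1)⁻¹

/-- The truncation at degree `n` of Euler's expansion of `∏_{i ≥ 1} (1 - z / Qⁱ)`. -/
noncomputable def eulerSum {A : Type*} [CommRing A] [Algebra ℝ A] (Q : ℝ) (n : ℕ) (z : A) : A :=
  ∑ k ∈ range (n + 1), algebraMap ℝ A ((-1) ^ k * eulerCoeff Q k) * z ^ k

lemma eulerCoeff_zero (Q : ℝ) : eulerCoeff Q 0 = 1 := by simp [eulerCoeff]

lemma eulerCoeff_succ {Q : ℝ} (hQ : 1 < Q) (k : ℕ) :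
    eulerCoeff Q (k + 1) * (Q ^ (k + 1) - 1) = eulerCoeff Q k := by
  have h : Q ^ (k + 1) - 1 ≠ 0 := (sub_pos.2 (one_lt_pow₀ hQ k.succ_ne_zero)).ne'
  rw [eulerCoeff, prod_range_succ, inv_mul_cancel_right₀ h, eulerCoeff]

lemma eulerCoeff_pos {Q : ℝ} (hQ : 1 < Q) (k : ℕ) : 0 < eulerCoeff Q k :=
  prod_pos fun _ _ => inv_pos.2 (sub_pos.2 (one_lt_pow₀ hQ (Nat.succ_ne_zero _)))

lemma eulerSum_succ {A : Type*} [CommRing A] [Algebra ℝ A] (Q : ℝ) (n : ℕ) (z : A) :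
    eulerSum Q (n + 1) z = eulerSum Q n z +
      algebraMap ℝ A ((-1) ^ (n + 1) * eulerCoeff Q (n + 1)) * z ^ (n + 1) := by
  rw [eulerSum, sum_range_succ, eulerSum]

lemma eulerSum_mul {A : Type*} [CommRing A] [Algebra ℝ A] {Q : ℝ} (hQ : 1 < Q) (n : ℕ) (z : A) :
    eulerSum Q n (algebraMap ℝ A Q * z) = (1 - z) * eulerSum Q n z +
      algebraMap ℝ A ((-1) ^ n * eulerCoeff Q n) * z ^ (n + 1) := by
  induction n with
  | zero => simp [eulerSum, eulerCoeff_zero]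
  | succ n ih =>
    rw [eulerSum_succ, eulerSum_succ, ih, ← eulerCoeff_succ hQ n]
    simp only [map_mul, map_pow, map_sub, map_neg, map_one]
    ring

lemma le_eulerSum {Q s : ℝ} (hQ : 4 ≤ Q) (hs : 0 ≤ s) (hs' : s ≤ 3) (n : ℕ) :
    1 - s / 3 ≤ eulerSum Q n s := by
  have hQ1 : 1 < Q := by linarith
  have hstep (k : ℕ) : eulerCoeff Q (k + 1) * s ^ (k + 1) ≤ eulerCoeff Q k * s ^ k := by
    have h1 : Q ≤ Q ^ (k + 1) := le_self_pow₀ hQ1.le k.succ_ne_zero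
    rw [← eulerCoeff_succ hQ1 k, pow_succ, mul_assoc, mul_comm (Q ^ (k + 1) - 1)]
    have := (eulerCoeff_pos hQ1 (k + 1)).le
    gcongr
    linarith
  have hnn (k : ℕ) : 0 ≤ eulerCoeff Q k * s ^ k :=
    mul_nonneg (eulerCoeff_pos hQ1 k).le (pow_nonneg hs k)
  have h1 : eulerCoeff Q 1 * s ≤ s / 3 := by
    have h := eulerCoeff_succ hQ1 0
    rw [eulerCoeff_zero] at h
    have := eulerCoeff_pos hQ1 1
    norm_num at h
    nlinarith
  have key : (Even n → 1 - s / 3 + eulerCoeff Q (n + 1) * s ^ (n + 1) ≤ eulerSum Q n s) ∧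
      (Odd n → 1 - s / 3 ≤ eulerSum Q n s) := by
    induction n with
    | zero =>
      simp only [eulerSum, zero_add, range_one, sum_singleton, pow_zero, eulerCoeff_zero, map_one,
        mul_one, pow_one, Nat.not_odd_zero, IsEmpty.forall_iff, and_true]
      intro
      linarith
    | succ n ih =>
      rw [eulerSum_succ]
      refine ⟨fun h => ?_, fun h => ?_⟩
      · have := ih.2 (by grind)
        have := hstep (n + 1)
        simp only [h.neg_one_pow, Algebra.algebraMap_self, RingHom.id_apply]
        linarith
      · have := ih.1 (by grind)
        simp only [h.neg_one_pow, Algebra.algebraMap_self, RingHom.id_apply]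
        linarith
  rcases n.even_or_odd with h | h
  · have := hnn (n + 1)
    linarith [key.1 h]
  · exact key.2 h

lemma prod_sub_one_ge {Q s : ℝ} (hQ : 4 ≤ Q) (hs : 1 / 2 ≤ s) (j : ℕ) :
    (1 - 1 / (3 * s)) * ∏ i ∈ range j, Q ^ (i + 1) * s ≤ ∏ i ∈ range j, (Q ^ (i + 1) * s - 1) := by
  have hs0 : 0 < s := by linarith
  have hQ0 : 0 < Q := by linarith
  have key : (1 - 1 / (3 * s) * (1 - (Q ^ j)⁻¹)) * ∏ i ∈ range j, Q ^ (i + 1) * s ≤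
      ∏ i ∈ range j, (Q ^ (i + 1) * s - 1) := by
    induction j with
    | zero => simp
    | succ j ih =>
      rw [prod_range_succ, prod_range_succ]
      have hP : 0 < ∏ i ∈ range j, Q ^ (i + 1) * s := by positivity
      have h4 : Q ≤ Q ^ (j + 1) := le_self_pow₀ (by linarith) j.succ_ne_zero
      have h5 : 0 ≤ Q ^ (j + 1) * s - 1 := by nlinarith
      refine le_trans ?_ (mul_le_mul_of_nonneg_right ih h5)
      set P := ∏ i ∈ range j, Q ^ (i + 1) * s
      rw [mul_comm P, ← mul_assoc, mul_right_comm _ P]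
      refine mul_le_mul_of_nonneg_right ?_ hP.le
      have hu : 0 < Q ^ j := by positivity
      have hu1 : 1 ≤ Q ^ j := one_le_pow₀ (by linarith)
      rw [pow_succ]
      set u := Q ^ j
      have e : (1 - 1 / (3 * s) * (1 - u⁻¹)) * (u * Q * s - 1) -
          (1 - 1 / (3 * s) * (1 - (u * Q)⁻¹)) * (u * Q * s) =
          ((Q - 4) * s * u + (u - 1)) / (3 * s * u) := by
        field_simp
        ring
      have : 0 ≤ ((Q - 4) * s * u + (u - 1)) / (3 * s * u) := by
        apply div_nonneg _ (by positivity)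
        have := mul_nonneg (mul_nonneg (sub_nonneg.2 hQ) hs0.le) hu.le
        linarith
      linarith
  refine le_trans (mul_le_mul_of_nonneg_right ?_ (by positivity)) key
  have : 0 ≤ 1 / (3 * s) * (Q ^ j)⁻¹ := by positivity
  linarith

lemma prod_pow_mul_prod_pow (Q : ℝ) (j d : ℕ) :
    (∏ i ∈ range j, Q ^ (i + 1)) * ∏ i ∈ range (j + 1 + d), Q ^ (i + 1) =
      Q ^ (j * (j + d + 2)) * Q ^ ((d + 1) * (d + 2) / 2) := by
  have h (k : ℕ) : ∏ i ∈ range k, Q ^ (i + 1) = Q ^ (k * (k + 1) / 2) := by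
    rw [prod_pow_eq_pow_sum]
    congr 1
    have := Finset.sum_range_id_mul_two (k + 1)
    rw [sum_range_succ'] at this
    simp at this
    rw [mul_comm k, ← this]; simp
  rw [h, h, ← pow_add, ← pow_add]
  congr 1
  obtain ⟨a, ha⟩ := (Nat.even_mul_succ_self j)
  obtain ⟨b, hb⟩ := (Nat.even_mul_succ_self (j + 1 + d))
  obtain ⟨c, hc⟩ := (Nat.even_mul_succ_self (d + 1))
  have hc' : (d + 1) * (d + 2) = c + c := hc
  rw [ha, hb, hc']
  have : (a + a) + (b + b) = 2 * (j * (j + d + 2)) + (c + c) := by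
    rw [← ha, ← hb, ← hc']; ring
  omega

/-- The error made when the functional equation of `eulerSum` is iterated along `s, Q s, Q² s, …`
as if it were that of the infinite product. -/
noncomputable def eulerError (Q : ℝ) (n : ℕ) (s : ℝ) : ℕ → ℝ
  | 0 => 0
  | j + 1 => (1 - Q ^ j * s) * eulerError Q n s j + eulerCoeff Q n * (Q ^ j * s) ^ (n + 1)

lemma eulerSum_pow_mul {Q : ℝ} (hQ : 1 < Q) (n : ℕ) (s : ℝ) (j : ℕ) :
    eulerSum Q n (Q ^ j * s) =
      eulerSum Q n s * ∏ i ∈ range j, (1 - Q ^ i * s) + (-1) ^ n * eulerError Q n s j := by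
  induction j with
  | zero => simp [eulerError]
  | succ j ih =>
    have h := eulerSum_mul hQ n (Q ^ j * s)
    simp only [Algebra.algebraMap_self, RingHom.id_apply] at h
    rw [pow_succ', mul_assoc, h, ih, prod_range_succ, eulerError]
    ring

lemma eulerError_bounds {Q s : ℝ} (hQ : 4 ≤ Q) (hs : 1 / 2 ≤ s) (hs' : s ≤ 2) {n j : ℕ}
    (hj : j < n) : 0 < eulerError Q n s (j + 1) ∧
      eulerError Q n s (j + 1) ≤ eulerCoeff Q n * (Q ^ j * s) ^ (n + 1) := by
  have hs0 : 0 < s := by linarith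
  have hQ0 : 0 < Q := by linarith
  have he := eulerCoeff_pos (show 1 < Q by linarith) n
  induction j with
  | zero => simp only [eulerError, mul_zero, zero_add, le_refl, and_true]; positivity
  | succ j ih =>
    obtain ⟨h1, h2⟩ := ih (by omega)
    rw [eulerError]
    have h4 : Q ≤ Q ^ (j + 1) := le_self_pow₀ (by linarith) j.succ_ne_zero
    have hy : 1 ≤ Q ^ (j + 1) * s := by nlinarith
    constructor
    · have h5 : Q ^ (j + 1) * s ≤ Q ^ (n + 1) := by
        calc Q ^ (j + 1) * s ≤ Q ^ n * Q := by
              gcongr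
              · linarith
              · linarith
          _ = _ := (pow_succ _ _).symm
      have h6 : (Q ^ (j + 1) * s - 1) * eulerError Q n s (j + 1) <
          Q ^ (n + 1) * (eulerCoeff Q n * (Q ^ j * s) ^ (n + 1)) := by
        apply mul_lt_mul (by linarith) h2 h1 (by positivity)
      have e : Q ^ (n + 1) * (eulerCoeff Q n * (Q ^ j * s) ^ (n + 1)) =
          eulerCoeff Q n * (Q ^ (j + 1) * s) ^ (n + 1) := by
        rw [pow_succ' Q j, mul_assoc Q, mul_pow Q]; ring
      linarith
    · nlinarith

/-- Size estimate at the test point `s = 1 ± p ^ (-(2d+1))`. -/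
lemma pow_lt_mul_pow {p : ℝ} (hp : 2 ≤ p) (d : ℕ) {s : ℝ}
    (hs : s = 1 - (-1) ^ d * (p ^ (2 * d + 1))⁻¹) :
    s ^ (d + 2) < 5 / 27 * ((p ^ (2 * d + 1))⁻¹ * (p ^ 2) ^ ((d + 1) * (d + 2) / 2)) := by
  have hp0 : 0 < p := by linarith
  have e : (p ^ (2 * d + 1))⁻¹ * (p ^ 2) ^ ((d + 1) * (d + 2) / 2) = p ^ (d ^ 2 + d + 1) := by
    rw [← pow_mul, Nat.mul_div_cancel' (Nat.even_mul_succ_self (d + 1)).two_dvd,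
      inv_mul_eq_iff_eq_mul₀ (by positivity), ← pow_add]
    congr 1; ring
  rw [e]
  rcases Nat.eq_zero_or_pos d with rfl | hd
  · simp only [pow_zero, one_mul, mul_zero, zero_add, pow_one] at hs
    simp only [hs, zero_add, ne_eq, OfNat.ofNat_ne_zero, not_false_eq_true, zero_pow, pow_one]
    have : (1 - p⁻¹) ^ 2 = (p - 1) ^ 2 / p ^ 2 := by field_simp
    rw [this, div_lt_iff₀ (by positivity)]
    nlinarith [sq_nonneg (p - 3), mul_nonneg hp0.le (sq_nonneg (p - 3)), pow_pos hp0 3]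
  · have hv : (p ^ (2 * d + 1))⁻¹ ≤ 1 / 8 := by
      rw [one_div]
      apply inv_anti₀ (by norm_num)
      calc (8 : ℝ) = 2 ^ 3 := by norm_num
        _ ≤ p ^ 3 := by gcongr
        _ ≤ p ^ (2 * d + 1) := pow_le_pow_right₀ (by linarith) (by omega)
    have hv0 : 0 < (p ^ (2 * d + 1))⁻¹ := by positivity
    have hs2 : s ≤ 9 / 8 ∧ 0 ≤ s := by
      rcases neg_one_pow_eq_or ℝ d with h | h <;> rw [h] at hs <;> constructor <;> linarith
    have h1 : s ^ (d + 2) ≤ (9 / 8) ^ (d + 2) := pow_le_pow_left₀ hs2.2 hs2.1 _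
    have h2 : (2 : ℝ) ^ (d + 2) ≤ p ^ (d ^ 2 + d + 1) :=
      calc (2 : ℝ) ^ (d + 2) ≤ p ^ (d + 2) := by gcongr
        _ ≤ _ := pow_le_pow_right₀ (by linarith) (by nlinarith)
    have h3 : ((9 : ℝ) / 16) ^ (d + 2) ≤ (9 / 16) ^ 3 :=
      pow_le_pow_of_le_one (by norm_num) (by norm_num) (by omega)
    have h4 : ((9 : ℝ) / 8) ^ (d + 2) = (9 / 16) ^ (d + 2) * 2 ^ (d + 2) := by
      rw [← mul_pow]; norm_num
    have h5 : (0 : ℝ) < 2 ^ (d + 2) := by positivity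
    nlinarith

lemma test_point_bounds {p : ℝ} (hp : 2 ≤ p) (d : ℕ) :
    1 / 2 ≤ 1 - (-1) ^ d * (p ^ (2 * d + 1))⁻¹ ∧ 1 - (-1) ^ d * (p ^ (2 * d + 1))⁻¹ ≤ 2 := by
  have hv : (p ^ (2 * d + 1))⁻¹ ≤ 1 / 2 := by
    rw [one_div]
    exact inv_anti₀ (by norm_num) (hp.trans (le_self_pow₀ (by linarith) (by omega)))
  have hv0 : 0 < (p ^ (2 * d + 1))⁻¹ := by positivity
  rcases neg_one_pow_eq_or ℝ d with h | h <;> rw [h] <;> constructor <;> linarith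

lemma eulerSum_test_point_neg {p : ℝ} (hp : 2 ≤ p) (j d : ℕ) {s : ℝ}
    (hs : s = 1 - (-1) ^ d * (p ^ (2 * d + 1))⁻¹) :
    (-1) ^ (j + 1 + d) * eulerSum (p ^ 2) (j + 1 + d) ((p ^ 2) ^ (j + 1) * s) < 0 := by
  have hQ : 4 ≤ p ^ 2 := by nlinarith
  have hp0 : 0 < p := by linarith
  obtain ⟨hs1, hs2⟩ := test_point_bounds hp d
  have hmain := pow_lt_mul_pow hp d hs
  rw [← hs] at hs1 hs2
  have hv0 : 0 < (p ^ (2 * d + 1))⁻¹ := by positivity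
  set v := (p ^ (2 * d + 1))⁻¹
  set Q := p ^ 2
  set n := j + 1 + d with hn
  have hQ1 : 1 < Q := by linarith
  have hQ0 : 0 < Q := by linarith
  have hs0 : 0 < s := by linarith
  have hE := eulerError_bounds hQ hs1 hs2 (show j < n by omega)
  have hP := le_eulerSum hQ hs0.le (by linarith) n
  have hA := prod_sub_one_ge hQ hs1 j
  have hW := prod_sub_one_ge hQ (show (1 : ℝ) / 2 ≤ 1 by norm_num) n
  have hWW := prod_pow_mul_prod_pow Q j d
  rw [prod_mul_distrib, prod_const, card_range] at hA
  simp only [mul_one] at hW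
  rw [← hn] at hWW
  set A := ∏ i ∈ range j, (Q ^ (i + 1) * s - 1)
  set W := ∏ i ∈ range j, Q ^ (i + 1)
  set V := ∏ i ∈ range n, Q ^ (i + 1)
  have hW0 : 0 < W := prod_pos fun _ _ => by positivity
  have hV0 : 0 < V := prod_pos fun _ _ => by positivity
  have he : eulerCoeff Q n * ∏ i ∈ range n, (Q ^ (i + 1) - 1) = 1 := by
    rw [eulerCoeff, ← prod_mul_distrib]
    exact prod_eq_one fun i _ =>
      inv_mul_cancel₀ (sub_pos.2 (one_lt_pow₀ hQ1 i.succ_ne_zero)).ne'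
  have he0 := eulerCoeff_pos hQ1 n
  have heV : eulerCoeff Q n * V ≤ 3 / 2 := by
    have := mul_le_mul_of_nonneg_left hW he0.le
    rw [he] at this
    linarith
  have hsum : 5 / 18 ≤ (1 - s / 3) * (1 - 1 / (3 * s)) := by
    have : (1 - s / 3) * (1 - 1 / (3 * s)) - 5 / 18 = (2 - s) * (2 * s - 1) / (6 * s) := by
      field_simp
      ring
    have : 0 ≤ (2 - s) * (2 * s - 1) / (6 * s) :=
      div_nonneg (mul_nonneg (by linarith) (by linarith)) (by positivity)
    linarith
  have hc0 : 0 ≤ 1 - 1 / (3 * s) := by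
    rw [sub_nonneg, div_le_one (by positivity)]; linarith
  have hPA : 5 / 18 * (W * s ^ j) ≤ eulerSum Q n s * A := by
    calc 5 / 18 * (W * s ^ j) ≤ ((1 - s / 3) * (1 - 1 / (3 * s))) * (W * s ^ j) := by gcongr
      _ = (1 - s / 3) * ((1 - 1 / (3 * s)) * (W * s ^ j)) := by ring
      _ ≤ _ := mul_le_mul hP hA (mul_nonneg hc0 (by positivity)) (le_trans (by linarith) hP)
  have hlt : eulerCoeff Q n * (Q ^ j * s) ^ (n + 1) < v * (eulerSum Q n s * A) := by
    refine lt_of_lt_of_le ?_ (mul_le_mul_of_nonneg_left hPA hv0.le)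
    refine lt_of_mul_lt_mul_right ?_ hV0.le
    calc eulerCoeff Q n * (Q ^ j * s) ^ (n + 1) * V
        = eulerCoeff Q n * V * (Q ^ j * s) ^ (n + 1) := by ring
      _ ≤ 3 / 2 * (Q ^ j * s) ^ (n + 1) := by gcongr
      _ = 3 / 2 * (Q ^ (j * (j + d + 2)) * s ^ j) * s ^ (d + 2) := by
        rw [hn, mul_pow, ← pow_mul]; ring
      _ < 3 / 2 * (Q ^ (j * (j + d + 2)) * s ^ j) *
          (5 / 27 * (v * Q ^ ((d + 1) * (d + 2) / 2))) := by gcongr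
      _ = 5 / 18 * v * s ^ j * (Q ^ (j * (j + d + 2)) * Q ^ ((d + 1) * (d + 2) / 2)) := by ring
      _ = v * (5 / 18 * (W * s ^ j)) * V := by rw [← hWW]; ring
  have hprod : ∏ i ∈ range (j + 1), (1 - Q ^ i * s) = (-1) ^ j * A * (1 - s) := by
    rw [prod_range_succ', pow_zero, one_mul]
    congr 1
    rw [← card_range j, ← prod_const, card_range, ← prod_mul_distrib]
    exact prod_congr rfl fun i _ => by ring
  rw [eulerSum_pow_mul hQ1, hprod]
  have e1 : (-1 : ℝ) ^ n * (-1) ^ n = 1 := by rw [← mul_pow]; norm_num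
  have e2 : (-1 : ℝ) ^ n * ((-1) ^ j * (-1) ^ d) = -1 := by
    rw [hn, ← pow_add, ← pow_add]
    exact Odd.neg_one_pow ⟨j + d, by ring⟩
  have e3 : 1 - s = (-1) ^ d * v := by rw [hs]; ring
  calc (-1) ^ n * (eulerSum Q n s * ((-1) ^ j * A * (1 - s)) + (-1) ^ n * eulerError Q n s (j + 1))
      = ((-1) ^ n * ((-1) ^ j * (-1) ^ d)) * (v * (eulerSum Q n s * A)) +
        ((-1) ^ n * (-1) ^ n) * eulerError Q n s (j + 1) := by rw [e3]; ring
    _ < 0 := by rw [e1, e2]; linarith [hE.2]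

lemma continuous_eulerSum (Q : ℝ) (n : ℕ) : Continuous (eulerSum Q n : ℝ → ℝ) := by
  unfold eulerSum
  fun_prop

lemma exists_eulerSum_eq_zero {p : ℝ} (hp : 2 ≤ p) (j d : ℕ) :
    ∃ s : ℝ, |s - 1| ≤ (p ^ (2 * d + 1))⁻¹ ∧
      eulerSum (p ^ 2) (j + 1 + d) ((p ^ 2) ^ (j + 1) * s) = 0 := by
  have hQ : 4 ≤ p ^ 2 := by nlinarith
  have h1 := eulerSum_test_point_neg hp j d rfl
  have h2 : 0 < (-1) ^ (j + 1 + d) * eulerSum (p ^ 2) (j + 1 + d) ((p ^ 2) ^ (j + 1) * 1) := by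
    have h := (eulerError_bounds hQ (show (1 : ℝ) / 2 ≤ 1 by norm_num) one_le_two
      (show j < j + 1 + d by omega)).1
    rw [eulerSum_pow_mul (by linarith), prod_range_succ']
    simp only [pow_zero, mul_one, sub_self, mul_zero, zero_add]
    rwa [← mul_assoc, ← mul_pow, neg_one_mul, neg_neg, one_pow, one_mul]
  have hc : Continuous fun s : ℝ =>
      (-1) ^ (j + 1 + d) * eulerSum (p ^ 2) (j + 1 + d) ((p ^ 2) ^ (j + 1) * s) :=
    continuous_const.mul ((continuous_eulerSum _ _).comp (by fun_prop))
  obtain ⟨s, hs, hs0⟩ := intermediate_value_uIcc (a := 1 - (-1) ^ d * (p ^ (2 * d + 1))⁻¹)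
    (b := 1) hc.continuousOn (Set.mem_uIcc_of_le h1.le h2.le)
  refine ⟨s, ?_, ?_⟩
  · have h := Set.abs_sub_le_of_uIcc_subset_uIcc (Set.uIcc_subset_uIcc_right hs)
    have hv0 : 0 < (p ^ (2 * d + 1))⁻¹ := by positivity
    rw [sub_sub_cancel, abs_mul, abs_pow, abs_neg, abs_one, one_pow, one_mul, abs_of_pos hv0] at h
    rwa [abs_sub_comm]
  · simpa using hs0

lemma eulerSum_map {A B : Type*} [CommRing A] [Algebra ℝ A] [CommRing B] [Algebra ℝ B]
    (f : A →ₐ[ℝ] B) (Q : ℝ) (n : ℕ) (z : A) : f (eulerSum Q n z) = eulerSum Q n (f z) := by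
  simp only [eulerSum, map_sum, map_mul f, map_pow f, AlgHom.commutes]

/-- The truncated Euler expansion is determined by its roots. -/
lemma prod_one_sub_eq_eulerSum {A : Type*} [CommRing A] [Algebra ℝ A] {Q : ℝ} {n : ℕ}
    {y : Fin n → ℝ} (hy : Function.Injective y) (hy0 : ∀ j, y j ≠ 0)
    (hroot : ∀ j, eulerSum Q n (y j) = 0) (z : A) :
    ∏ j, (1 - algebraMap ℝ A (y j)⁻¹ * z) = eulerSum Q n z := by
  open Polynomial in
  have hpoly : ∏ j, (1 - C (y j)⁻¹ * X) = (eulerSum Q n X : ℝ[X]) := by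
    rw [← sub_eq_zero]
    refine eq_zero_of_natDegree_lt_card_of_eval_eq_zero _ (f := Fin.cons 0 y)
      (Fin.cons_injective_iff.2 ⟨fun ⟨j, hj⟩ => hy0 j hj, hy⟩) (fun i => ?_) ?_
    · have he (t : ℝ) : eval t (eulerSum Q n X : ℝ[X]) = eulerSum Q n t := by
        rw [← coe_aeval_eq_eval, eulerSum_map, aeval_X]
      rw [eval_sub, eval_prod, he]
      induction i using Fin.cases with
      | zero => simp [eulerSum, sum_range_succ', eulerCoeff_zero]
      | succ j =>
        rw [Fin.cons_succ, hroot, sub_zero]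
        exact prod_eq_zero (mem_univ j) (by simp [hy0 j])
    · rw [Fintype.card_fin, Nat.lt_succ_iff]
      refine (natDegree_sub_le _ _).trans (max_le ?_ ?_)
      · refine (natDegree_prod_le _ _).trans ?_
        calc _ ≤ ∑ j : Fin n, 1 := sum_le_sum fun j _ => by compute_degree
          _ = n := by simp
      · refine natDegree_sum_le_of_forall_le _ _ fun k hk => ?_
        exact (natDegree_C_mul_X_pow_le _ _).trans (Nat.lt_succ_iff.1 (mem_range.1 hk))
  have h := congrArg (Polynomial.aeval z) hpoly
  rw [eulerSum_map, map_prod] at h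
  simpa using h

/-- A complex polynomial with constant coefficient `1` is a product of factors `1 - γ X`. -/
lemma exists_eq_prod_one_sub {T : Polynomial ℂ} (hT : T.coeff 0 = 1) :
    ∃ g : Multiset ℂ, T = (g.map fun c => 1 - Polynomial.C c * Polynomial.X).prod := by
  open Polynomial in
  have hT0 : T ≠ 0 := by rintro rfl; simp at hT
  have h := (IsAlgClosed.splits T).eq_prod_roots
  have hr : ∀ r ∈ T.roots, r ≠ 0 := by
    rintro r hr rfl
    rw [mem_roots hT0, IsRoot, ← coeff_zero_eq_eval_zero, hT] at hr
    exact one_ne_zero hr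
  have hfac : (T.roots.map fun r => X - C r) =
      T.roots.map fun r => C (-r) * (1 - C r⁻¹ * X) := by
    refine Multiset.map_congr rfl fun r hrm => ?_
    rw [mul_sub, ← mul_assoc, ← C_mul, neg_mul, mul_inv_cancel₀ (hr r hrm)]
    simp only [C_neg, C_1]
    ring
  rw [hfac, Multiset.prod_map_mul, Multiset.prod_hom' _ (C : ℂ →+* ℂ[X]), ← mul_assoc, ← C_mul] at h
  set c := T.leadingCoeff * (T.roots.map fun r => -r).prod
  have hc : c = 1 := by
    have h' := congrArg (eval 0) h
    rw [← coeff_zero_eq_eval_zero, hT, eval_mul, eval_C, eval_multiset_prod] at h'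
    simpa using h'.symm
  refine ⟨T.roots.map fun r => r⁻¹, ?_⟩
  rw [Multiset.map_map]
  simpa [hc] using h

/-- If two products `∏ (1 - βᵢ w)` agree at all multiples of `z`, then so do the products
`∏ T (βᵢ z)` for every polynomial `T` with constant coefficient `1`. -/
lemma prod_aeval_eq_of_prod_one_sub_eq {A ι κ : Type*} [CommRing A] [Algebra ℂ A]
    {s : Finset ι} {t : Finset κ} {b : ι → ℂ} {c : κ → ℂ} {z : A}
    (h : ∀ g : ℂ, ∏ i ∈ s, (1 - algebraMap ℂ A (b i) * (algebraMap ℂ A g * z)) =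
      ∏ i ∈ t, (1 - algebraMap ℂ A (c i) * (algebraMap ℂ A g * z)))
    {T : Polynomial ℂ} (hT : T.coeff 0 = 1) :
    ∏ i ∈ s, Polynomial.aeval (algebraMap ℂ A (b i) * z) T =
      ∏ i ∈ t, Polynomial.aeval (algebraMap ℂ A (c i) * z) T := by
  obtain ⟨g, rfl⟩ := exists_eq_prod_one_sub hT
  simp only [map_multiset_prod, Multiset.map_map, Function.comp_def, map_sub, map_one, map_mul,
    Polynomial.aeval_C, Polynomial.aeval_X]
  rw [← Multiset.prod_map_prod, ← Multiset.prod_map_prod]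
  congr 1
  refine Multiset.map_congr rfl fun x _ => ?_
  simpa only [mul_left_comm] using h x

/-- The power series of `sinh t / t`. -/
noncomputable def sinhc : PowerSeries ℂ :=
  PowerSeries.mk fun m => if Even m then ((m + 1).factorial : ℂ)⁻¹ else 0

/-- The moment generating series of a uniform variable on `{p - 1, p - 3, …, 1 - p}`, up to the
factor `p`. -/
noncomputable def progressionSeries (p : ℕ) : PowerSeries ℂ :=
  ∑ k : Fin p, PowerSeries.rescale ((p : ℂ) - 1 - 2 * ((k : ℕ) : ℂ)) (PowerSeries.exp ℂ)

lemma two_X_mul_sinhc : PowerSeries.C (2 : ℂ) * PowerSeries.X * sinhc =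
    PowerSeries.exp ℂ - PowerSeries.rescale (-1) (PowerSeries.exp ℂ) := by
  ext m
  rw [mul_assoc, PowerSeries.coeff_C_mul, map_sub, PowerSeries.coeff_rescale]
  cases m with
  | zero => simp
  | succ m =>
    rw [PowerSeries.coeff_succ_X_mul, sinhc, PowerSeries.coeff_mk, PowerSeries.coeff_exp]
    rcases m.even_or_odd with h | h
    · rw [if_pos h, h.add_one.neg_one_pow]
      simp
      ring
    · rw [if_neg (Nat.not_even_iff_odd.2 h), h.add_one.neg_one_pow]
      simp

lemma rescale_sinhc_mul_progressionSeries (p : ℕ) :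
    PowerSeries.C (p : ℂ) * PowerSeries.rescale (p : ℂ) sinhc = sinhc * progressionSeries p := by
  open PowerSeries in
  have h2 : (C (2 : ℂ) * X : PowerSeries ℂ) ≠ 0 :=
    mul_ne_zero (fun h => two_ne_zero (C_injective (h.trans (map_zero C).symm))) X_ne_zero
  apply mul_left_cancel₀ h2
  have e1 : C (2 : ℂ) * X * (C (p : ℂ) * rescale (p : ℂ) sinhc) =
      rescale (p : ℂ) (C (2 : ℂ) * X * sinhc) := by
    rw [map_mul, map_mul, rescale_X]
    have : rescale (p : ℂ) (C (2 : ℂ)) = C 2 := by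
      ext m; rw [coeff_rescale, coeff_C]; split_ifs with h <;> simp [h]
    rw [this]
    ring
  rw [e1, ← mul_assoc, two_X_mul_sinhc, map_sub, rescale_rescale, progressionSeries,
    Fin.sum_univ_eq_sum_range fun k => rescale ((p : ℂ) - 1 - 2 * (k : ℂ)) (PowerSeries.exp ℂ),
    mul_sum]
  have e2 (k : ℕ) : (PowerSeries.exp ℂ - rescale (-1) (PowerSeries.exp ℂ)) *
      rescale ((p : ℂ) - 1 - 2 * (k : ℂ)) (PowerSeries.exp ℂ) =
      rescale ((p : ℂ) - 2 * (k : ℂ)) (PowerSeries.exp ℂ) -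
      rescale ((p : ℂ) - 2 * ((k + 1 : ℕ) : ℂ)) (PowerSeries.exp ℂ) := by
    have h1 : PowerSeries.exp ℂ = rescale (1 : ℂ) (PowerSeries.exp ℂ) := by simp
    rw [sub_mul]
    nth_rewrite 1 [h1]
    rw [exp_mul_exp_eq_exp_add, exp_mul_exp_eq_exp_add]
    congr 3
    · ring
    · push_cast; ring
  simp only [e2]
  rw [sum_range_sub']
  simp only [Nat.cast_zero, mul_zero, sub_zero]
  congr 3
  ring

/-- The polynomial `∑_{k ≤ n} X ^ k / (2k+1)!`, a truncation of `sinh √X / √X`. -/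
noncomputable def sinhcPoly (n : ℕ) : Polynomial ℂ :=
  ∑ k ∈ range (n + 1), Polynomial.C ((2 * k + 1).factorial : ℂ)⁻¹ * Polynomial.X ^ k

lemma sinhcPoly_coeff_zero (n : ℕ) : (sinhcPoly n).coeff 0 = 1 := by
  simp [sinhcPoly, sum_range_succ', Polynomial.coeff_X_pow]

lemma X_pow_dvd_rescale_sinhc_sub (n : ℕ) (r : ℂ) :
    (PowerSeries.X : PowerSeries ℂ) ^ (2 * n + 2) ∣ PowerSeries.rescale r sinhc -
      Polynomial.aeval (algebraMap ℂ (PowerSeries ℂ) (r ^ 2) * PowerSeries.X ^ 2)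
        (sinhcPoly n) := by
  rw [PowerSeries.X_pow_dvd_iff]
  intro m hm
  have e : Polynomial.aeval (algebraMap ℂ (PowerSeries ℂ) (r ^ 2) * PowerSeries.X ^ 2)
      (sinhcPoly n) = ∑ k ∈ range (n + 1), PowerSeries.C
        (((2 * k + 1).factorial : ℂ)⁻¹ * r ^ (2 * k)) * PowerSeries.X ^ (2 * k) := by
    simp only [sinhcPoly, map_sum, map_mul, Polynomial.aeval_C, map_pow, Polynomial.aeval_X]
    refine sum_congr rfl fun k _ => ?_
    simp only [PowerSeries.algebraMap_apply, Algebra.algebraMap_self, RingHom.id_apply]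
    ring
  rw [e, map_sub, map_sum, PowerSeries.coeff_rescale, sinhc, PowerSeries.coeff_mk, sub_eq_zero]
  simp only [PowerSeries.coeff_C_mul, PowerSeries.coeff_X_pow]
  split_ifs with h
  · obtain ⟨l, rfl⟩ := h.two_dvd
    rw [sum_eq_single l (fun k _ hk => by simp [hk.symm])
      (fun hl => absurd (mem_range.2 (by omega)) hl)]
    simp [mul_comm]
  · rw [mul_zero, eq_comm]
    refine sum_eq_zero fun k _ => ?_
    rw [if_neg (by rintro rfl; simp at h), mul_zero]

/-- If the numbers `(aⱼ²)⁻¹` are the roots of the truncated Euler expansion, then the product of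
the moment generating series of the `aⱼ Xⱼ` agrees with `sinh t / t` to order `2n`. -/
lemma X_pow_dvd_prod_sub {p : ℕ} (hp : 2 ≤ p) {n : ℕ} {a y : Fin n → ℝ}
    (hy : Function.Injective y) (hy0 : ∀ j, y j ≠ 0)
    (hroot : ∀ j, eulerSum ((p : ℝ) ^ 2) n (y j) = 0) (ha : ∀ j, a j ^ 2 = (y j)⁻¹) :
    (PowerSeries.X : PowerSeries ℂ) ^ (2 * n + 2) ∣
      ∏ j, PowerSeries.rescale (a j : ℂ) (progressionSeries p) -
        PowerSeries.C ((p : ℂ) ^ n) * sinhc := by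
  have hQ : (1 : ℝ) < (p : ℝ) ^ 2 := one_lt_pow₀ (by exact_mod_cast hp) two_ne_zero
  set I : Ideal (PowerSeries ℂ) := Ideal.span {(PowerSeries.X : PowerSeries ℂ) ^ (2 * n + 2)}
  have hI (f : PowerSeries ℂ) :
      (PowerSeries.X : PowerSeries ℂ) ^ (2 * n + 2) ∣ f ↔ Ideal.Quotient.mk I f = 0 := by
    rw [Ideal.Quotient.eq_zero_iff_mem, Ideal.mem_span_singleton]
  set z : PowerSeries ℂ ⧸ I := Ideal.Quotient.mk I (PowerSeries.X ^ 2) with hz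
  have hzn : z ^ (n + 1) = 0 := by
    rw [hz, ← map_pow, ← hI, ← pow_mul]
    exact pow_dvd_pow _ (by omega)
  have hS (r : ℂ) : Ideal.Quotient.mk I (PowerSeries.rescale r sinhc) =
      Polynomial.aeval (algebraMap ℂ (PowerSeries ℂ ⧸ I) (r ^ 2) * z) (sinhcPoly n) := by
    have h := (hI _).1 (X_pow_dvd_rescale_sinhc_sub n r)
    rw [map_sub, sub_eq_zero] at h
    rw [h]
    have := Polynomial.aeval_algHom_apply (Ideal.Quotient.mkₐ ℂ I)
      (algebraMap ℂ (PowerSeries ℂ) (r ^ 2) * PowerSeries.X ^ 2) (sinhcPoly n)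
    rw [map_mul, AlgHom.commutes] at this
    exact this.symm
  have hscal (r : ℝ) : algebraMap ℂ (PowerSeries ℂ ⧸ I) (r : ℂ) = algebraMap ℝ _ r :=
    (IsScalarTower.algebraMap_apply ℝ ℂ (PowerSeries ℂ ⧸ I) r).symm
  have hE (w : PowerSeries ℂ ⧸ I) (hw : w ^ (n + 1) = 0) :
      ∏ j, (1 - algebraMap ℂ (PowerSeries ℂ ⧸ I) (((p : ℂ) * a j) ^ 2) * w) =
        (1 - w) * ∏ j, (1 - algebraMap ℂ (PowerSeries ℂ ⧸ I) ((a j : ℂ) ^ 2) * w) := by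
    have h1 (j : Fin n) : algebraMap ℂ (PowerSeries ℂ ⧸ I) ((a j : ℂ) ^ 2) =
        algebraMap ℝ _ (y j)⁻¹ := by rw [← ha, ← hscal]; push_cast; rfl
    have h2 (j : Fin n) : algebraMap ℂ (PowerSeries ℂ ⧸ I) (((p : ℂ) * a j) ^ 2) * w =
        algebraMap ℝ _ (y j)⁻¹ * (algebraMap ℝ _ ((p : ℝ) ^ 2) * w) := by
      rw [← h1, ← hscal, ← mul_assoc, ← map_mul]
      push_cast
      ring
    simp only [h1, h2]
    rw [prod_one_sub_eq_eulerSum hy hy0 hroot, prod_one_sub_eq_eulerSum hy hy0 hroot,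
      eulerSum_mul hQ, hw, mul_zero, add_zero]
  have hprod := prod_aeval_eq_of_prod_one_sub_eq (s := (univ : Finset (Fin n)))
    (t := (univ : Finset (Fin (n + 1)))) (b := fun j => ((p : ℂ) * a j) ^ 2)
    (c := Fin.cons (1 ^ 2) fun j => (a j : ℂ) ^ 2) (z := z) (fun g => by
      rw [hE _ (by rw [mul_pow, hzn, mul_zero]), Fin.prod_univ_succ]
      simp) (sinhcPoly_coeff_zero n)
  rw [Fin.prod_univ_succ] at hprod
  simp only [Fin.cons_zero, Fin.cons_succ, ← hS, ← map_prod, ← map_mul] at hprod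
  have hfac (j : Fin n) : PowerSeries.C (p : ℂ) * PowerSeries.rescale ((p : ℂ) * a j) sinhc =
      PowerSeries.rescale (a j : ℂ) sinhc *
        PowerSeries.rescale (a j : ℂ) (progressionSeries p) := by
    have h := congrArg (PowerSeries.rescale (a j : ℂ)) (rescale_sinhc_mul_progressionSeries p)
    rw [map_mul, map_mul, PowerSeries.rescale_rescale] at h
    have hC : PowerSeries.rescale (a j : ℂ) (PowerSeries.C (p : ℂ)) = PowerSeries.C (p : ℂ) := by
      ext m
      rw [PowerSeries.coeff_rescale, PowerSeries.coeff_C]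
      split_ifs with h <;> simp [h]
    rwa [hC] at h
  have hunit : IsUnit (∏ j, PowerSeries.rescale (a j : ℂ) sinhc) := by
    rw [PowerSeries.isUnit_iff_constantCoeff, map_prod]
    simp [sinhc, ← PowerSeries.coeff_zero_eq_constantCoeff_apply]
  rw [hI, map_sub, sub_eq_zero]
  apply (hunit.map (Ideal.Quotient.mk I)).mul_left_cancel
  rw [← map_mul, ← prod_mul_distrib, ← map_mul]
  simp only [← hfac]
  rw [prod_mul_distrib, map_mul, hprod, ← map_mul, prod_const, card_univ, Fintype.card_fin]
  congr 1
  rw [map_pow, PowerSeries.rescale_one, RingHom.id_apply]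
  ring

/-- The number whose base `p` digits, most significant first, are `x 0, …, x (n - 1)`. -/
def ofDigitsRev (p n : ℕ) (x : Fin n → Fin p) : ℕ := ∑ j, (x j : ℕ) * p ^ (n - 1 - (j : ℕ))

lemma ofDigitsRev_succ (p n : ℕ) (x : Fin (n + 1) → Fin p) :
    ofDigitsRev p (n + 1) x = x 0 * p ^ n + ofDigitsRev p n (Fin.tail x) := by
  rw [ofDigitsRev, Fin.sum_univ_succ, ofDigitsRev]
  congr 1
  refine sum_congr rfl fun j _ => ?_
  rw [Fin.tail, Fin.val_succ]
  congr 2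
  omega

lemma ofDigitsRev_lt (p n : ℕ) (x : Fin n → Fin p) : ofDigitsRev p n x < p ^ n := by
  induction n with
  | zero => simp [ofDigitsRev]
  | succ n ih =>
    rw [ofDigitsRev_succ]
    have h1 := ih (Fin.tail x)
    have h2 : ((x 0 : ℕ) + 1) * p ^ n ≤ p * p ^ n := Nat.mul_le_mul_right _ (x 0).2
    rw [pow_succ']
    linarith

lemma ofDigitsRev_lt_of_lex {p n : ℕ} {x y : Fin n → Fin p} (i : Fin n)
    (h : ∀ j < i, x j = y j) (hi : y i < x i) : ofDigitsRev p n y < ofDigitsRev p n x := by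
  induction n with
  | zero => exact i.elim0
  | succ n ih =>
    rw [ofDigitsRev_succ, ofDigitsRev_succ]
    induction i using Fin.cases with
    | zero =>
      have h1 := ofDigitsRev_lt p n (Fin.tail y)
      have h2 : ((y 0 : ℕ) + 1) * p ^ n ≤ x 0 * p ^ n := Nat.mul_le_mul_right _ hi
      linarith
    | succ i =>
      rw [h 0 i.succ_pos]
      have := ih (x := Fin.tail x) (y := Fin.tail y) i
        (fun j hj => h j.succ (Fin.succ_lt_succ_iff.2 hj)) hi
      omega

lemma exists_first_ne {n : ℕ} {α : Type*} {x y : Fin n → α} (h : x ≠ y) :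
    ∃ i, (∀ j < i, x j = y j) ∧ x i ≠ y i := by
  obtain ⟨i, hi, hmin⟩ := WellFounded.has_min (wellFounded_lt (α := Fin n)) {i | x i ≠ y i}
    (Function.ne_iff.1 h)
  exact ⟨i, fun j hj => by_contra fun hne => hmin j hne hj, hi⟩

lemma ofDigitsRev_injective (p n : ℕ) : Function.Injective (ofDigitsRev p n) := by
  intro x y hxy
  by_contra hne
  obtain ⟨i, hlt, hi⟩ := exists_first_ne hne
  rcases lt_or_gt_of_ne hi with h | h
  · exact (ofDigitsRev_lt_of_lex i (fun j hj => (hlt j hj).symm) h).ne hxy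
  · exact (ofDigitsRev_lt_of_lex i hlt h).ne hxy.symm

lemma exists_ofDigitsRev_eq {p n k : ℕ} (hk : k < p ^ n) : ∃ x, ofDigitsRev p n x = k := by
  have hb : Function.Bijective fun x => (⟨ofDigitsRev p n x, ofDigitsRev_lt p n x⟩ : Fin (p ^ n)) :=
    (Fintype.bijective_iff_injective_and_card _).2
      ⟨fun x y h => ofDigitsRev_injective p n (congrArg Fin.val h), by simp⟩
  obtain ⟨x, hx⟩ := hb.2 ⟨k, hk⟩
  exact ⟨x, congrArg Fin.val hx⟩

lemma sum_mul_inv_pow {p : ℝ} (hp : p ≠ 0) (n : ℕ) :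
    ∑ j : Fin n, (p - 1) * (p ^ ((j : ℕ) + 1))⁻¹ = 1 - (p ^ n)⁻¹ := by
  rw [Fin.sum_univ_eq_sum_range fun j => (p - 1) * (p ^ (j + 1))⁻¹]
  induction n with
  | zero => simp
  | succ n ih =>
    rw [sum_range_succ, ih]
    field_simp
    ring

lemma midpt_eq {p : ℕ} (hp : 0 < p) (n : ℕ) (x : Fin n → Fin p) :
    midpt p n x = 1 - ((p : ℝ) ^ n)⁻¹ - 2 * ofDigitsRev p n x / (p : ℝ) ^ n := by
  have hp' : (p : ℝ) ≠ 0 := by positivity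
  rw [← sum_mul_inv_pow hp', midpt, ofDigitsRev, Nat.cast_sum, mul_sum, sum_div,
    ← sum_sub_distrib]
  refine sum_congr rfl fun j _ => ?_
  have h : (p : ℝ) ^ n = p ^ (n - 1 - (j : ℕ)) * p ^ ((j : ℕ) + 1) := by
    rw [← pow_add]
    congr 1
    omega
  rw [h]
  push_cast
  field_simp

lemma abs_value_le {p : ℕ} (k : Fin p) : |(p : ℝ) - 1 - 2 * ((k : ℕ) : ℝ)| ≤ p - 1 := by
  have h1 : ((k : ℕ) : ℝ) + 1 ≤ p := by exact_mod_cast k.2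
  have h0 : (0 : ℝ) ≤ ((k : ℕ) : ℝ) := by positivity
  rw [abs_le]
  constructor <;> linarith

lemma abs_Xsum_sub_midpt_lt {p n : ℕ} (hp : 1 ≤ p) {a : Fin n → ℝ}
    (ha : ∀ j, |a j - ((p : ℝ) ^ ((j : ℕ) + 1))⁻¹| ≤ (p : ℝ) ^ (j : ℕ) / (p : ℝ) ^ (2 * n))
    (x : Fin n → Fin p) : |Xsum p n a x - midpt p n x| < ((p : ℝ) ^ n)⁻¹ := by
  have hp1 : (1 : ℝ) ≤ p := by exact_mod_cast hp
  have e : Xsum p n a x - midpt p n x =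
      ∑ j, (a j - ((p : ℝ) ^ ((j : ℕ) + 1))⁻¹) * ((p : ℝ) - 1 - 2 * ((x j : ℕ) : ℝ)) := by
    rw [Xsum, midpt, ← sum_sub_distrib]
    exact sum_congr rfl fun j _ => by ring
  rw [e]
  calc _ ≤ ∑ j : Fin n, (p : ℝ) ^ (j : ℕ) / (p : ℝ) ^ (2 * n) * (p - 1) := by
        refine (abs_sum_le_sum_abs _ _).trans (sum_le_sum fun j _ => ?_)
        rw [abs_mul]
        exact mul_le_mul (ha j) (abs_value_le _) (abs_nonneg _) (by positivity)
    _ = ((p : ℝ) ^ n - 1) / (p : ℝ) ^ (2 * n) := by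
        rw [← geom_sum_mul, ← Fin.sum_univ_eq_sum_range, sum_mul, sum_div]
        exact sum_congr rfl fun j _ => by ring
    _ < _ := by
        rw [div_lt_iff₀ (by positivity), two_mul, pow_add, inv_mul_cancel_left₀ (by positivity)]
        linarith

/-- If each `Xsum` is within `p ^ (-n)` of its ruler midpoint, then the values occupy the `p ^ n`
equal subintervals of `[-1, 1]` once each, in dictionary order. -/
lemma Xsum_location_and_order {p n : ℕ} (hp : 1 ≤ p) {a : Fin n → ℝ}
    (ha : ∀ x, |Xsum p n a x - midpt p n x| < ((p : ℝ) ^ n)⁻¹) :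
      (∀ x : Fin n → Fin p,
        Xsum p n a x ∈
          Set.Ioo (midpt p n x - ((p : ℝ) ^ n)⁻¹) (midpt p n x + ((p : ℝ) ^ n)⁻¹) ∧
        Set.Ioo (midpt p n x - ((p : ℝ) ^ n)⁻¹) (midpt p n x + ((p : ℝ) ^ n)⁻¹)
          ⊆ Set.Ioo (-1 : ℝ) 1) ∧
      (∀ i : Fin (p ^ n), ∃! x : Fin n → Fin p,
        Xsum p n a x ∈ Set.Ioo (-1 + 2 * (i : ℕ) / (p : ℝ) ^ n)
          (-1 + 2 * ((i : ℕ) + 1) / (p : ℝ) ^ n)) ∧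
      (∀ x y : Fin n → Fin p,
        Xsum p n a x < Xsum p n a y ↔
          toLex (fun j => ((p : ℝ) - 1 - 2 * ((x j : ℕ) : ℝ)))
            < toLex (fun j => ((p : ℝ) - 1 - 2 * ((y j : ℕ) : ℝ)))) := by
  have hq : (0 : ℝ) < (p : ℝ) ^ n := by positivity
  -- in the units `1 / p ^ n` the intervals have integer endpoints
  have key (x : Fin n → Fin p) :
      (p : ℝ) ^ n - 2 * ofDigitsRev p n x - 2 < Xsum p n a x * (p : ℝ) ^ n ∧
      Xsum p n a x * (p : ℝ) ^ n < (p : ℝ) ^ n - 2 * ofDigitsRev p n x := by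
    have h := abs_lt.1 (ha x)
    rw [midpt_eq hp] at h
    have e1 : (1 - ((p : ℝ) ^ n)⁻¹ - 2 * ofDigitsRev p n x / (p : ℝ) ^ n) * (p : ℝ) ^ n =
      (p : ℝ) ^ n - 1 - 2 * ofDigitsRev p n x := by field_simp
    have e2 : ((p : ℝ) ^ n)⁻¹ * (p : ℝ) ^ n = 1 := inv_mul_cancel₀ hq.ne'
    have h1 := mul_lt_mul_of_pos_right h.1 hq
    have h2 := mul_lt_mul_of_pos_right h.2 hq
    rw [sub_mul, e1] at h1 h2
    constructor <;> linarith
  have hanti {x y : Fin n → Fin p} (h : ofDigitsRev p n y < ofDigitsRev p n x) :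
      Xsum p n a x < Xsum p n a y := by
    have h' : (ofDigitsRev p n y : ℝ) + 1 ≤ ofDigitsRev p n x := by exact_mod_cast h
    refine lt_of_mul_lt_mul_right ?_ hq.le
    linarith [(key x).2, (key y).1]
  refine ⟨fun x => ⟨?_, ?_⟩, fun i => ?_, fun x y => ?_⟩
  · have h := abs_lt.1 (ha x)
    constructor <;> linarith
  · have h0 : (0 : ℝ) ≤ ofDigitsRev p n x / (p : ℝ) ^ n := by positivity
    have h1 : (ofDigitsRev p n x / (p : ℝ) ^ n : ℝ) + ((p : ℝ) ^ n)⁻¹ ≤ 1 := by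
      rw [inv_eq_one_div, ← add_div, div_le_one hq]
      exact_mod_cast ofDigitsRev_lt p n x
    apply Set.Ioo_subset_Ioo <;> rw [midpt_eq hp, mul_div_assoc] <;> linarith
  · have hmem (x : Fin n → Fin p) : Xsum p n a x ∈ Set.Ioo (-1 + 2 * (i : ℕ) / (p : ℝ) ^ n)
        (-1 + 2 * ((i : ℕ) + 1) / (p : ℝ) ^ n) ↔ ofDigitsRev p n x + i + 1 = p ^ n := by
      have e (t : ℝ) : -1 + 2 * t / (p : ℝ) ^ n = (2 * t - (p : ℝ) ^ n) / (p : ℝ) ^ n := by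
        field_simp
        ring
      rw [Set.mem_Ioo, e, e, div_lt_iff₀ hq, lt_div_iff₀ hq]
      obtain ⟨h1, h2⟩ := key x
      constructor
      · rintro ⟨h3, h4⟩
        have h5 : ((ofDigitsRev p n x + i : ℕ) : ℝ) < ((p ^ n : ℕ) : ℝ) := by
          push_cast; linarith
        have h6 : ((p ^ n : ℕ) : ℝ) < ((ofDigitsRev p n x + i + 2 : ℕ) : ℝ) := by
          push_cast; linarith
        rw [Nat.cast_lt] at h5 h6
        omega
      · intro h
        have h' : (ofDigitsRev p n x : ℝ) + (i : ℕ) + 1 = (p : ℝ) ^ n := by exact_mod_cast h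
        constructor <;> linarith
    obtain ⟨x, hx⟩ := exists_ofDigitsRev_eq (p := p) (n := n) (k := p ^ n - 1 - i) (by omega)
    refine ⟨x, (hmem x).2 (by omega), fun y hy => ofDigitsRev_injective p n ?_⟩
    have := (hmem y).1 hy
    omega
  · have hlex {x y : Fin n → Fin p} (i : Fin n) (h : ∀ j < i, x j = y j) (hi : y i < x i) :
        toLex (fun j => ((p : ℝ) - 1 - 2 * ((x j : ℕ) : ℝ)))
            < toLex (fun j => ((p : ℝ) - 1 - 2 * ((y j : ℕ) : ℝ))) := by
      have hi' : ((y i : ℕ) : ℝ) < ((x i : ℕ) : ℝ) := by exact_mod_cast hi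
      refine ⟨i, fun j hj => ?_, ?_⟩
      · simp [h j hj]
      · change (p : ℝ) - 1 - 2 * ((x i : ℕ) : ℝ) < (p : ℝ) - 1 - 2 * ((y i : ℕ) : ℝ)
        linarith
    by_cases hxy : x = y
    · subst hxy
      exact iff_of_false (lt_irrefl _) (lt_irrefl _)
    obtain ⟨i, hlt, hi⟩ := exists_first_ne hxy
    rcases lt_or_gt_of_ne hi with h | h
    · have hlt' : ∀ j < i, y j = x j := fun j hj => (hlt j hj).symm
      exact iff_of_false (hanti (ofDigitsRev_lt_of_lex i hlt' h)).not_gt (hlex i hlt' h).not_gt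
    · exact iff_of_true (hanti (ofDigitsRev_lt_of_lex i hlt h)) (hlex i hlt h)

lemma prod_rescale_exp {ι : Type*} (s : Finset ι) (c : ι → ℂ) :
    ∏ j ∈ s, PowerSeries.rescale (c j) (PowerSeries.exp ℂ) =
      PowerSeries.rescale (∑ j ∈ s, c j) (PowerSeries.exp ℂ) := by
  classical
  induction s using Finset.induction_on with
  | empty =>
    ext m
    rw [prod_empty, sum_empty, PowerSeries.coeff_rescale, PowerSeries.coeff_one]
    cases m <;> simp
  | insert i s hi ih =>
    rw [prod_insert hi, sum_insert hi, ih, PowerSeries.exp_mul_exp_eq_exp_add]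

lemma prod_rescale_progressionSeries (p n : ℕ) (a : Fin n → ℝ) :
    ∏ j, PowerSeries.rescale (a j : ℂ) (progressionSeries p) =
      ∑ x : Fin n → Fin p, PowerSeries.rescale (Xsum p n a x : ℂ) (PowerSeries.exp ℂ) := by
  simp only [progressionSeries, map_sum, PowerSeries.rescale_rescale]
  rw [prod_univ_sum, Fintype.piFinset_univ]
  refine sum_congr rfl fun x _ => ?_
  rw [prod_rescale_exp, Xsum]
  push_cast
  congr 2
  exact sum_congr rfl fun j _ => mul_comm _ _

lemma matchesMoments_of_eulerSum_eq_zero {p : ℕ} (hp : 2 ≤ p) {n : ℕ} {a y : Fin n → ℝ}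
    (hy : Function.Injective y) (hy0 : ∀ j, y j ≠ 0)
    (hroot : ∀ j, eulerSum ((p : ℝ) ^ 2) n (y j) = 0) (ha : ∀ j, a j ^ 2 = (y j)⁻¹) :
    MatchesMoments p n a := by
  intro m _ hm
  have h := PowerSeries.X_pow_dvd_iff.1 (X_pow_dvd_prod_sub hp hy hy0 hroot ha) m (by omega)
  rw [prod_rescale_progressionSeries, map_sub, map_sum, PowerSeries.coeff_C_mul, sub_eq_zero] at h
  simp only [PowerSeries.coeff_rescale, sinhc, PowerSeries.coeff_mk, PowerSeries.coeff_exp] at h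
  rw [← sum_mul] at h
  have hp0 : (p : ℝ) ^ n ≠ 0 := by positivity
  have hm0 : ((m.factorial : ℕ) : ℝ) ≠ 0 := by positivity
  have h' : (∑ x, Xsum p n a x ^ m) * ((m.factorial : ℕ) : ℝ)⁻¹ =
      (p : ℝ) ^ n * if Even m then (((m + 1).factorial : ℕ) : ℝ)⁻¹ else 0 := by
    rw [← Complex.ofReal_inj]
    split_ifs at h ⊢ <;> simpa using h
  rw [mul_inv_eq_iff_eq_mul₀ hm0] at h'
  rw [h']
  split_ifs
  · rw [Nat.factorial_succ]
    push_cast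
    field_simp
  · simp

lemma abs_inv_sqrt_sub_one_le {s v : ℝ} (hv0 : 0 ≤ v) (hv : v ≤ 1 / 2) (hs : |s - 1| ≤ v) :
    |(√s)⁻¹ - 1| ≤ v := by
  obtain ⟨h1, h2⟩ := abs_le.1 hs
  have hs0 : 0 < s := by linarith
  have hr : 0 < √s := Real.sqrt_pos.2 hs0
  rw [abs_le]
  constructor
  · have : √s * (1 - v) ≤ 1 := by
      rw [← Real.sqrt_sq (show 0 ≤ 1 - v by linarith), ← Real.sqrt_mul hs0.le, Real.sqrt_le_one]
      nlinarith [mul_le_mul_of_nonneg_right h2 (sq_nonneg (1 - v)), pow_nonneg hv0 3,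
        mul_nonneg hv0 hv0]
    have := (le_inv_mul_iff₀ hr).2 this
    linarith
  · have : 1 ≤ √s * (1 + v) := by
      rw [← Real.sqrt_sq (show 0 ≤ 1 + v by linarith), ← Real.sqrt_mul hs0.le, Real.one_le_sqrt]
      nlinarith [mul_le_mul_of_nonneg_right h1 (sq_nonneg (1 + v)), mul_nonneg hv0 hv0,
        mul_nonneg (mul_nonneg hv0 hv0) (sub_nonneg.2 hv)]
    have := (inv_mul_le_iff₀ hr).2 this
    linarith

theorem stmt_1 (p : ℕ) (hp : 2 ≤ p) (n : ℕ) (hn : 1 ≤ n) :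
    ∃ a : Fin n → ℝ,
      StrictAnti a ∧ (∀ j, 0 < a j) ∧ MatchesMoments p n a ∧
      (∀ x : Fin n → Fin p,
        Xsum p n a x ∈
          Set.Ioo (midpt p n x - ((p : ℝ) ^ n)⁻¹) (midpt p n x + ((p : ℝ) ^ n)⁻¹) ∧
        Set.Ioo (midpt p n x - ((p : ℝ) ^ n)⁻¹) (midpt p n x + ((p : ℝ) ^ n)⁻¹)
          ⊆ Set.Ioo (-1 : ℝ) 1) ∧
      (∀ i : Fin (p ^ n), ∃! x : Fin n → Fin p,
        Xsum p n a x ∈ Set.Ioo (-1 + 2 * (i : ℕ) / (p : ℝ) ^ n)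
          (-1 + 2 * ((i : ℕ) + 1) / (p : ℝ) ^ n)) ∧
      (∀ x y : Fin n → Fin p,
        Xsum p n a x < Xsum p n a y ↔
          toLex (fun j => ((p : ℝ) - 1 - 2 * ((x j : ℕ) : ℝ)))
            < toLex (fun j => ((p : ℝ) - 1 - 2 * ((y j : ℕ) : ℝ)))) := by
  have hp2 : (2 : ℝ) ≤ p := by exact_mod_cast hp
  have hp0 : (0 : ℝ) < p := by linarith
  have hex (j : Fin n) : ∃ s : ℝ, |s - 1| ≤ ((p : ℝ) ^ (2 * (n - 1 - (j : ℕ)) + 1))⁻¹ ∧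
      eulerSum ((p : ℝ) ^ 2) n (((p : ℝ) ^ 2) ^ ((j : ℕ) + 1) * s) = 0 := by
    have h := exists_eulerSum_eq_zero hp2 j (n - 1 - j)
    rwa [show (j : ℕ) + 1 + (n - 1 - j) = n by omega] at h
  choose s hs hroot using hex
  have hv (j : Fin n) : ((p : ℝ) ^ (2 * (n - 1 - (j : ℕ)) + 1))⁻¹ ≤ 1 / 2 := by
    rw [one_div]
    exact inv_anti₀ (by norm_num) (hp2.trans (le_self_pow₀ (by linarith) (by omega)))
  have hs1 (j : Fin n) : 1 / 2 ≤ s j := by linarith [(abs_le.1 (hs j)).1, hv j]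
  have hs2 (j : Fin n) : s j ≤ 3 / 2 := by linarith [(abs_le.1 (hs j)).2, hv j]
  set y : Fin n → ℝ := fun j => ((p : ℝ) ^ 2) ^ ((j : ℕ) + 1) * s j with hy
  have hy0 (j : Fin n) : 0 < y j := mul_pos (by positivity) (by linarith [hs1 j])
  have hmono : StrictMono y := by
    intro i j hij
    have hQ : 4 ≤ (p : ℝ) ^ 2 := by nlinarith
    have h1 : ((p : ℝ) ^ 2) ^ ((i : ℕ) + 1) * (p : ℝ) ^ 2 ≤ ((p : ℝ) ^ 2) ^ ((j : ℕ) + 1) := by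
      rw [← pow_succ]
      exact pow_le_pow_right₀ (by linarith) (by rw [Fin.lt_def] at hij; omega)
    have h2 : 0 < ((p : ℝ) ^ 2) ^ ((i : ℕ) + 1) := by positivity
    simp only [hy]
    nlinarith [mul_le_mul_of_nonneg_left (hs2 i) h2.le, mul_le_mul_of_nonneg_left hQ h2.le,
      mul_le_mul h1 (hs1 j) (by norm_num) (by positivity)]
  have ha (j : Fin n) : (√(y j))⁻¹ = ((p : ℝ) ^ ((j : ℕ) + 1))⁻¹ * (√(s j))⁻¹ := by
    rw [← mul_inv]
    simp only [hy]
    rw [Real.sqrt_mul (by positivity), ← pow_mul, mul_comm 2, pow_mul,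
      Real.sqrt_sq (by positivity)]
  have hclose (j : Fin n) : |(√(y j))⁻¹ - ((p : ℝ) ^ ((j : ℕ) + 1))⁻¹| ≤
      (p : ℝ) ^ (j : ℕ) / (p : ℝ) ^ (2 * n) := by
    have hpos : 0 < ((p : ℝ) ^ ((j : ℕ) + 1))⁻¹ := by positivity
    rw [ha, ← mul_sub_one, abs_mul, abs_of_pos hpos]
    refine (mul_le_mul_of_nonneg_left
      (abs_inv_sqrt_sub_one_le (by positivity) (hv j) (hs j)) hpos.le).trans_eq ?_
    have e : (p : ℝ) ^ (2 * n) =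
        (p : ℝ) ^ (j : ℕ) * ((p : ℝ) ^ ((j : ℕ) + 1) * (p : ℝ) ^ (2 * (n - 1 - (j : ℕ)) + 1)) := by
      rw [← pow_add, ← pow_add]
      congr 1
      omega
    rw [e]
    field_simp
  refine ⟨fun j => (√(y j))⁻¹, fun i j hij => ?_, fun j => inv_pos.2 (Real.sqrt_pos.2 (hy0 j)),
    matchesMoments_of_eulerSum_eq_zero hp hmono.injective (fun j => (hy0 j).ne') hroot
      fun j => by rw [inv_pow, Real.sq_sqrt (hy0 j).le],
    Xsum_location_and_order (by omega) (abs_Xsum_sub_midpt_lt (by omega) hclose)⟩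
  exact inv_strictAnti₀ (Real.sqrt_pos.2 (hy0 i)) (Real.sqrt_lt_sqrt (hy0 i).le (hmono hij))
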